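/- arXiv:2110.05440 — 2 statements merged into one kernel-verified Lean document; each statement's English description precedes it below -/
import Mathlib

section
/- Preservation of a finite human objective under the robot backup action (Lemma 5): Suppose uR0 ∈ ÛR. Let x' ∈ 𝒳 and let uH : ℕ → 𝒰H be a sequence with J_H(x', uH) > ⊥. Set x = f_H(x', uH 0) and x₊' = f_R(x, uR0). Then J_H(x₊', uH ∘ (·+1)) > ⊥, and consequently J_H(x₊') > ⊥. -/
variable {𝒳 𝒰R 𝒰H : Type*}

/-- Primed states of the human-first trajectory ζ_H(x', uH, uR):
`trajP fR fH x' uH uR t` is x'_t, where x'_0 = x',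
x_t = fH (x'_t) (uH t), and x'_{t+1} = fR (x_t) (uR t). -/
def trajP (fR : 𝒳 → 𝒰R → 𝒳) (fH : 𝒳 → 𝒰H → 𝒳) (x' : 𝒳)
    (uH : ℕ → 𝒰H) (uR : ℕ → 𝒰R) : ℕ → 𝒳
  | 0 => x'
  | t + 1 => fR (fH (trajP fR fH x' uH uR t) (uH t)) (uR t)

/-- The human-first trajectory is safe up to time k. -/
def SafeUpTo (fR : 𝒳 → 𝒰R → 𝒳) (fH : 𝒳 → 𝒰H → 𝒳) (Xsafe : Set 𝒳)
    (x' : 𝒳) (uH : ℕ → 𝒰H) (uR : ℕ → 𝒰R) (k : ℕ) : Prop :=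
  ∀ t ≤ k, trajP fR fH x' uH uR t ∈ Xsafe ∧
    fH (trajP fR fH x' uH uR t) (uH t) ∈ Xsafe

/-- Safe equilibrium states. -/
def Xeq (fR : 𝒳 → 𝒰R → 𝒳) (fH : 𝒳 → 𝒰H → 𝒳) (Xsafe : Set 𝒳)
    (uR0 : 𝒰R) (UH0 : Set 𝒰H) : Set 𝒳 :=
  {x | x ∈ Xsafe ∧ fR x uR0 = x ∧ ∀ uH ∈ UH0, fH x uH = x}

/-- Recoverable states. -/
def Xrec (fR : 𝒳 → 𝒰R → 𝒳) (fH : 𝒳 → 𝒰H → 𝒳) (Xsafe : Set 𝒳)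
    (uR0 : 𝒰R) (UH0 : Set 𝒰H) (k : ℕ) : Set 𝒳 :=
  {x' | ∀ uH : ℕ → 𝒰H, (∀ t, uH t ∈ UH0) →
    SafeUpTo fR fH Xsafe x' uH (fun _ => uR0) k ∧
    fH (trajP fR fH x' uH (fun _ => uR0) k) (uH k) ∈ Xeq fR fH Xsafe uR0 UH0}

open Filter in
/-- Discounted objective of a human-first trajectory, computed in `EReal`
as the liminf of the partial sums. -/
noncomputable def J (fR : 𝒳 → 𝒰R → 𝒳) (fH : 𝒳 → 𝒰H → 𝒳)
    (rH : 𝒳 → 𝒰H → 𝒳 → EReal) (γ : ℝ)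
    (x' : 𝒳) (uH : ℕ → 𝒰H) (uR : ℕ → 𝒰R) : EReal :=
  Filter.atTop.liminf fun n => ∑ t ∈ Finset.range n,
    ((γ ^ t : ℝ) : EReal) *
      rH (trajP fR fH x' uH uR t) (uH t) (fH (trajP fR fH x' uH uR t) (uH t))

/-- Robust human objective: worst case over anticipated robot action sequences. -/
noncomputable def JH (fR : 𝒳 → 𝒰R → 𝒳) (fH : 𝒳 → 𝒰H → 𝒳)
    (rH : 𝒳 → 𝒰H → 𝒳 → EReal) (γ : ℝ) (URhat : Set 𝒰R)
    (x' : 𝒳) (uH : ℕ → 𝒰H) : EReal :=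
  ⨅ uR : {u : ℕ → 𝒰R // ∀ t, u t ∈ URhat}, J fR fH rH γ x' uH uR.val

/-- Human value: best case over human action sequences. -/
noncomputable def JHval (fR : 𝒳 → 𝒰R → 𝒳) (fH : 𝒳 → 𝒰H → 𝒳)
    (rH : 𝒳 → 𝒰H → 𝒳 → EReal) (γ : ℝ) (URhat : Set 𝒰R) (x' : 𝒳) : EReal :=
  ⨆ uH : ℕ → 𝒰H, JH fR fH rH γ URhat x' uH

/-- Dropping the first step of a trajectory gives the trajectory started one step later. -/
theorem trajP_succ_eq_shift (fR : 𝒳 → 𝒰R → 𝒳) (fH : 𝒳 → 𝒰H → 𝒳) (x' : 𝒳)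
    (uH : ℕ → 𝒰H) (uR : ℕ → 𝒰R) (t : ℕ) :
    trajP fR fH x' uH uR (t + 1) =
      trajP fR fH (fR (fH x' (uH 0)) (uR 0)) (fun t => uH (t + 1)) (fun t => uR (t + 1)) t := by
  induction t with
  | zero => rfl
  | succ t ih => rw [trajP, ih, trajP]

/-- Discounted partial sums in `EReal` split off their first term. -/
theorem sum_range_succ_discounted {γ : ℝ} (hγ : 0 ≤ γ) (r : ℕ → EReal) (n : ℕ) :
    ∑ t ∈ Finset.range (n + 1), ((γ ^ t : ℝ) : EReal) * r t =
      r 0 + (γ : EReal) * ∑ t ∈ Finset.range n, ((γ ^ t : ℝ) : EReal) * r (t + 1) := by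
  induction n with
  | zero => simp
  | succ n ih =>
    rw [Finset.sum_range_succ, ih, Finset.sum_range_succ,
      EReal.left_distrib_of_nonneg_of_ne_top (EReal.coe_nonneg.2 hγ) (EReal.coe_ne_top γ),
      ← add_assoc, ← mul_assoc, ← EReal.coe_mul, ← pow_succ']

open Filter in
/-- A first term `⊥` forces the liminf of the discounted partial sums to be `⊥`. -/
theorem liminf_discounted_eq_bot {γ : ℝ} (hγ : 0 ≤ γ) {r : ℕ → EReal} (h : r 0 = ⊥) :
    atTop.liminf (fun n => ∑ t ∈ Finset.range n, ((γ ^ t : ℝ) : EReal) * r t) = ⊥ := by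
  rw [← liminf_nat_add _ 1]
  simp only [sum_range_succ_discounted hγ, h, EReal.bot_add, liminf_const]

open Filter in
/-- A lower bound on the liminf of discounted partial sums, passed to the sums without their
first term. -/
theorem le_liminf_discounted_shift {γ c m : ℝ} (hγ : 0 < γ) {r : ℕ → EReal} (hc : r 0 = c)
    (h : (m : EReal) <
      atTop.liminf fun n => ∑ t ∈ Finset.range n, ((γ ^ t : ℝ) : EReal) * r t) :
    (((m - c) / γ : ℝ) : EReal) ≤
      atTop.liminf fun n => ∑ t ∈ Finset.range n, ((γ ^ t : ℝ) : EReal) * r (t + 1) := by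
  rw [← liminf_nat_add _ 1] at h
  refine le_liminf_of_le (h := ?_)
  filter_upwards [eventually_lt_of_lt_liminf h] with n hn
  rw [sum_range_succ_discounted hγ.le, hc] at hn
  rw [EReal.coe_div, EReal.div_le_iff_le_mul (EReal.coe_pos.2 hγ) (EReal.coe_ne_top γ),
    EReal.coe_sub]
  exact EReal.sub_le_of_le_add' hn.le

/-- Preservation of a finite human objective under the robot backup action (Lemma 5). -/
theorem JH_backup_preserved (fR : 𝒳 → 𝒰R → 𝒳) (fH : 𝒳 → 𝒰H → 𝒳)
    (uR0 : 𝒰R) (γ : ℝ) (hγ0 : 0 < γ) (hγ1 : γ < 1) (URhat : Set 𝒰R)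
    (rH : 𝒳 → 𝒰H → 𝒳 → EReal)
    (hrtop : ∀ x' u x, rH x' u x < ⊤)
    (hA2 : uR0 ∈ URhat)
    (x' : 𝒳) (uH : ℕ → 𝒰H)
    (hJ : JH fR fH rH γ URhat x' uH > ⊥) :
    JH fR fH rH γ URhat (fR (fH x' (uH 0)) uR0) (fun t => uH (t + 1)) > ⊥ ∧
    JHval fR fH rH γ URhat (fR (fH x' (uH 0)) uR0) > ⊥ := by
  have hlow : ∀ uR : ℕ → 𝒰R, (∀ t, uR t ∈ URhat) →
      JH fR fH rH γ URhat x' uH ≤ J fR fH rH γ x' uH uR :=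
    fun uR huR => iInf_le (fun uR : {u : ℕ → 𝒰R // ∀ t, u t ∈ URhat} =>
      J fR fH rH γ x' uH uR.val) ⟨uR, huR⟩
  have hbot : rH x' (uH 0) (fH x' (uH 0)) ≠ ⊥ := fun h =>
    (hJ.trans_le (hlow (fun _ => uR0) fun _ => hA2)).ne'
      (liminf_discounted_eq_bot hγ0.le
        (r := fun t => rH (trajP fR fH x' uH (fun _ => uR0) t) (uH t)
          (fH (trajP fR fH x' uH (fun _ => uR0) t) (uH t))) h)
  obtain ⟨c, hc⟩ : ∃ c : ℝ, rH x' (uH 0) (fH x' (uH 0)) = c :=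
    ⟨_, (EReal.coe_toReal (hrtop _ _ _).ne hbot).symm⟩
  obtain ⟨m, -, hm⟩ := EReal.lt_iff_exists_real_btwn.1 hJ
  have hJH : JH fR fH rH γ URhat (fR (fH x' (uH 0)) uR0) (fun t => uH (t + 1)) > ⊥ := by
    refine (EReal.bot_lt_coe ((m - c) / γ)).trans_le (le_iInf fun v => ?_)
    let w : ℕ → 𝒰R := fun t => t.casesOn uR0 v.val
    have hw : ∀ t, w t ∈ URhat
      | 0 => hA2
      | t + 1 => v.property t
    have h := le_liminf_discounted_shift hγ0
      (r := fun t => rH (trajP fR fH x' uH w t) (uH t) (fH (trajP fR fH x' uH w t) (uH t)))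
      hc (hm.trans_le (hlow w hw))
    simp only [trajP_succ_eq_shift] at h
    exact h
  exact ⟨hJH, hJH.trans_le (le_iSup (JH fR fH rH γ URhat _) _)⟩
end

section
/- Main safety theorem (Theorem 1, safety modulo fault): Under Assumptions 1, 2, 3, the argmax-attainment property of π_H, and the shield property of π_R, assume additionally that UH0 is nonempty and that x₀ ∈ Xeq. Define the robot-first closed-loop trajectory by x_0 = x₀, x'_t = f_R(x_t, π_R (x_t)), and x_{t+1} = f_H(x'_t, π_H (x'_t)). Then x_t ∈ Xsafe and x'_t ∈ Xsafe for all t ∈ ℕ. -/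
variable {𝒳 𝒰R 𝒰H : Type*}

/-- Invariant states. -/
noncomputable def Xinv (fR : 𝒳 → 𝒰R → 𝒳) (fH : 𝒳 → 𝒰H → 𝒳) (Xsafe : Set 𝒳)
    (uR0 : 𝒰R) (UH0 : Set 𝒰H) (k : ℕ)
    (rH : 𝒳 → 𝒰H → 𝒳 → EReal) (γ : ℝ) (URhat : Set 𝒰R)
    (πH : 𝒳 → 𝒰H) (πR : 𝒳 → 𝒰R) : Set 𝒳 :=
  {x' | JHval fR fH rH γ URhat x' > ⊥ ∨
    fR (fH x' (πH x')) (πR (fH x' (πH x'))) ∈ Xrec fR fH Xsafe uR0 UH0 k}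

/-- States from which every human backup sequence keeps the trajectory safe forever, as long as
the robot plays its backup action. -/
def backupSafe (fR : 𝒳 → 𝒰R → 𝒳) (fH : 𝒳 → 𝒰H → 𝒳) (Xsafe : Set 𝒳)
    (uR0 : 𝒰R) (UH0 : Set 𝒰H) : Set 𝒳 :=
  {x' | ∀ uH : ℕ → 𝒰H, (∀ t, uH t ∈ UH0) → ∀ t,
    SafeUpTo fR fH Xsafe x' uH (fun _ => uR0) t}

/-- The sequence with first term `a` followed by the terms of `u`. -/
def seqCons {α : Type*} (a : α) (u : ℕ → α) : ℕ → α
  | 0 => a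
  | n + 1 => u n

theorem seqCons_mem {α : Type*} {s : Set α} {a : α} (ha : a ∈ s) {u : ℕ → α}
    (hu : ∀ n, u n ∈ s) : ∀ n, seqCons a u n ∈ s
  | 0 => ha
  | n + 1 => hu n

theorem trajP_succ' (fR : 𝒳 → 𝒰R → 𝒳) (fH : 𝒳 → 𝒰H → 𝒳) (x' : 𝒳)
    (uH : ℕ → 𝒰H) (uR : ℕ → 𝒰R) (t : ℕ) :
    trajP fR fH x' uH uR (t + 1) =
      trajP fR fH (fR (fH x' (uH 0)) (uR 0)) (fun n => uH (n + 1)) (fun n => uR (n + 1)) t := by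
  induction t with
  | zero => rfl
  | succ t ih => rw [trajP, ih]; rfl

theorem fH_trajP_of_mem_Xeq {fR : 𝒳 → 𝒰R → 𝒳} {fH : 𝒳 → 𝒰H → 𝒳} {Xsafe : Set 𝒳}
    {uR0 : 𝒰R} {UH0 : Set 𝒰H} {x' : 𝒳} {uH : ℕ → 𝒰H} (huH : ∀ t, uH t ∈ UH0) {k : ℕ}
    (hk : fH (trajP fR fH x' uH (fun _ => uR0) k) (uH k) ∈ Xeq fR fH Xsafe uR0 UH0) (m : ℕ) :
    fH (trajP fR fH x' uH (fun _ => uR0) (k + m)) (uH (k + m)) =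
      fH (trajP fR fH x' uH (fun _ => uR0) k) (uH k) := by
  induction m with
  | zero => rfl
  | succ m ih =>
    rw [← add_assoc, trajP, ih, hk.2.1, hk.2.2 _ (huH _)]

theorem Xrec_subset_backupSafe (fR : 𝒳 → 𝒰R → 𝒳) (fH : 𝒳 → 𝒰H → 𝒳) (Xsafe : Set 𝒳)
    (uR0 : 𝒰R) (UH0 : Set 𝒰H) (k : ℕ) :
    Xrec fR fH Xsafe uR0 UH0 k ⊆ backupSafe fR fH Xsafe uR0 UH0 := by
  intro x' hx' uH huH _ t _
  obtain ⟨hsafe, hk⟩ := hx' uH huH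
  rcases le_or_gt t k with htk | htk
  · exact hsafe t htk
  · obtain ⟨m, rfl⟩ := Nat.exists_eq_add_of_lt htk
    refine ⟨?_, ?_⟩
    · rw [trajP, fH_trajP_of_mem_Xeq huH hk, hk.2.1]
      exact hk.1
    · rw [add_assoc, fH_trajP_of_mem_Xeq huH hk]
      exact hk.1

theorem Xeq_subset_backupSafe (fR : 𝒳 → 𝒰R → 𝒳) (fH : 𝒳 → 𝒰H → 𝒳) (Xsafe : Set 𝒳)
    (uR0 : 𝒰R) (UH0 : Set 𝒰H) :
    Xeq fR fH Xsafe uR0 UH0 ⊆ backupSafe fR fH Xsafe uR0 UH0 := by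
  intro x' hx'
  refine Xrec_subset_backupSafe fR fH Xsafe uR0 UH0 0 fun uH huH => ?_
  have h : fH x' (uH 0) = x' := hx'.2.2 _ (huH 0)
  refine ⟨fun t ht => ?_, ?_⟩
  · obtain rfl : t = 0 := Nat.le_zero.mp ht
    simpa only [trajP, h, and_self] using hx'.1
  · simpa only [trajP, h] using hx'

theorem backupSafe_step {fR : 𝒳 → 𝒰R → 𝒳} {fH : 𝒳 → 𝒰H → 𝒳} {Xsafe : Set 𝒳}
    {uR0 : 𝒰R} {UH0 : Set 𝒰H} {x' : 𝒳} (hx' : x' ∈ backupSafe fR fH Xsafe uR0 UH0)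
    {u : 𝒰H} (hu : u ∈ UH0) : fR (fH x' u) uR0 ∈ backupSafe fR fH Xsafe uR0 UH0 := by
  intro uH huH _ t _
  have h := hx' (seqCons u uH) (seqCons_mem hu huH) (t + 1) (t + 1) le_rfl
  rwa [trajP_succ'] at h

/-- If a reward along the trajectory is `⊥`, so is the discounted objective. -/
theorem J_eq_bot {fR : 𝒳 → 𝒰R → 𝒳} {fH : 𝒳 → 𝒰H → 𝒳} {rH : 𝒳 → 𝒰H → 𝒳 → EReal} {γ : ℝ}
    (hγ : 0 < γ) {x' : 𝒳} {uH : ℕ → 𝒰H} {uR : ℕ → 𝒰R} (t : ℕ)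
    (h : rH (trajP fR fH x' uH uR t) (uH t) (fH (trajP fR fH x' uH uR t) (uH t)) = ⊥) :
    J fR fH rH γ x' uH uR = ⊥ := by
  rw [J, Filter.liminf_congr (v := fun _ => (⊥ : EReal)), Filter.liminf_const]
  filter_upwards [Filter.eventually_gt_atTop t] with n hn
  rw [← Finset.add_sum_erase _ _ (Finset.mem_range.mpr hn), h,
    EReal.coe_mul_bot_of_pos (pow_pos hγ t), EReal.bot_add]

theorem EReal.coe_sum_real {ι : Type*} (s : Finset ι) (f : ι → ℝ) :
    ((∑ i ∈ s, f i : ℝ) : EReal) = ∑ i ∈ s, (f i : EReal) :=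
  map_sum (⟨⟨Real.toEReal, EReal.coe_zero⟩, EReal.coe_add⟩ : ℝ →+ EReal) f s

/-- A lower bound for the objective after one step in terms of a lower bound before it. -/
theorem div_le_J_step {fR : 𝒳 → 𝒰R → 𝒳} {fH : 𝒳 → 𝒰H → 𝒳} {rH : 𝒳 → 𝒰H → 𝒳 → EReal}
    {γ : ℝ} (hγ : 0 < γ) (hrtop : ∀ x' u x, rH x' u x < ⊤) {x' : 𝒳} {uH : ℕ → 𝒰H}
    {uR : ℕ → 𝒰R} {c : ℝ} (hc : (c : EReal) < J fR fH rH γ x' uH uR) :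
    (((c - (rH x' (uH 0) (fH x' (uH 0))).toReal) / γ : ℝ) : EReal) ≤
      J fR fH rH γ (fR (fH x' (uH 0)) (uR 0)) (fun n => uH (n + 1)) (fun n => uR (n + 1)) := by
  have hfin : ∀ t, ∃ ρ : ℝ, rH (trajP fR fH x' uH uR t) (uH t)
      (fH (trajP fR fH x' uH uR t) (uH t)) = (ρ : EReal) := fun t =>
    ⟨_, (EReal.coe_toReal (hrtop _ _ _).ne fun h =>
      not_lt_bot (J_eq_bot hγ t h ▸ hc)).symm⟩
  choose ρ hρ using hfin
  have h0 : rH x' (uH 0) (fH x' (uH 0)) = (ρ 0 : EReal) := hρ 0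
  rw [J] at hc ⊢
  have hev := Filter.eventually_lt_of_lt_liminf hc
  refine Filter.le_liminf_of_le (by isBoundedDefault) ?_
  filter_upwards [(Filter.tendsto_add_atTop_nat 1).eventually hev] with n hn
  simp only [← trajP_succ', hρ, ← EReal.coe_mul, ← EReal.coe_sum_real] at hn ⊢
  rw [EReal.coe_lt_coe_iff, Finset.sum_range_succ'] at hn
  rw [h0, EReal.toReal_coe, EReal.coe_le_coe_iff, div_le_iff₀ hγ, Finset.sum_mul]
  have hshift : ∑ t ∈ Finset.range n, γ ^ (t + 1) * ρ (t + 1) =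
      ∑ t ∈ Finset.range n, γ ^ t * ρ (t + 1) * γ :=
    Finset.sum_congr rfl fun t _ => by ring
  rw [hshift] at hn
  linarith

theorem bot_lt_JH_step {fR : 𝒳 → 𝒰R → 𝒳} {fH : 𝒳 → 𝒰H → 𝒳} {rH : 𝒳 → 𝒰H → 𝒳 → EReal}
    {γ : ℝ} (hγ : 0 < γ) (hrtop : ∀ x' u x, rH x' u x < ⊤) {URhat : Set 𝒰R} {uR0 : 𝒰R}
    (huR0 : uR0 ∈ URhat) {x' : 𝒳} {uH : ℕ → 𝒰H} (h : ⊥ < JH fR fH rH γ URhat x' uH) :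
    ⊥ < JH fR fH rH γ URhat (fR (fH x' (uH 0)) uR0) (fun n => uH (n + 1)) := by
  obtain ⟨c, -, hc⟩ := EReal.lt_iff_exists_real_btwn.mp h
  have hbound : (((c - (rH x' (uH 0) (fH x' (uH 0))).toReal) / γ : ℝ) : EReal) ≤
      JH fR fH rH γ URhat (fR (fH x' (uH 0)) uR0) (fun n => uH (n + 1)) := by
    rw [JH]
    refine le_iInf fun uR => ?_
    have hlt : (c : EReal) < J fR fH rH γ x' uH (seqCons uR0 uR.val) :=
      hc.trans_le (iInf_le (fun v : {u : ℕ → 𝒰R // ∀ t, u t ∈ URhat} =>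
        J fR fH rH γ x' uH v.val) ⟨_, seqCons_mem huR0 uR.2⟩)
    have hstep := div_le_J_step hγ hrtop hlt
    simpa only [seqCons] using hstep
  exact (EReal.bot_lt_coe _).trans_le hbound

/-- Main safety theorem (Theorem 1, safety modulo fault). -/
theorem safety_modulo_fault (fR : 𝒳 → 𝒰R → 𝒳) (fH : 𝒳 → 𝒰H → 𝒳) (Xsafe : Set 𝒳)
    (uR0 : 𝒰R) (UH0 : Set 𝒰H) (k : ℕ)
    (γ : ℝ) (hγ0 : 0 < γ) (hγ1 : γ < 1) (URhat : Set 𝒰R)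
    (rH : 𝒳 → 𝒰H → 𝒳 → EReal)
    (hrtop : ∀ x' u x, rH x' u x < ⊤)
    (hA1 : ∀ x' u x, x' ∉ Xsafe ∨ x ∉ Xsafe → rH x' u x = ⊥)
    (hA2 : uR0 ∈ URhat)
    (πH : 𝒳 → 𝒰H)
    (hπHmax : ∀ x' : 𝒳, JHval fR fH rH γ URhat x' > ⊥ →
      ∃ uH : ℕ → 𝒰H, uH 0 = πH x' ∧
        JH fR fH rH γ URhat x' uH = JHval fR fH rH γ URhat x')
    (hA3 : ∀ x' : 𝒳, JHval fR fH rH γ URhat x' = ⊥ → πH x' ∈ UH0)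
    (πR : 𝒳 → 𝒰R)
    (hshield : ∀ x : 𝒳, πR x ≠ uR0 → fR x (πR x) ∈ Xrec fR fH Xsafe uR0 UH0 k)
    (hUH0 : UH0.Nonempty)
    (x₀ : 𝒳) (hx₀ : x₀ ∈ Xeq fR fH Xsafe uR0 UH0)
    (x : ℕ → 𝒳)
    (hx0 : x 0 = x₀)
    (hxsucc : ∀ t, x (t + 1) = fH (fR (x t) (πR (x t))) (πH (fR (x t) (πR (x t))))) :
    ∀ t, x t ∈ Xsafe ∧ fR (x t) (πR (x t)) ∈ Xsafe := by
  have hval : ∀ x', JHval fR fH rH γ URhat x' > ⊥ →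
      (x' ∈ Xsafe ∧ fH x' (πH x') ∈ Xsafe) ∧
        JHval fR fH rH γ URhat (fR (fH x' (πH x')) uR0) > ⊥ := by
    intro x' hx'
    obtain ⟨uH, h0, heq⟩ := hπHmax x' hx'
    have hpos : ⊥ < JH fR fH rH γ URhat x' uH := heq ▸ hx'
    refine ⟨?_, ?_⟩
    · by_contra hns
      have hbot : J fR fH rH γ x' uH (fun _ => uR0) = ⊥ :=
        J_eq_bot hγ0 0 (hA1 _ _ _ (by simpa only [trajP, h0] using not_and_or.mp hns))
      have hlt : ⊥ < J fR fH rH γ x' uH (fun _ => uR0) :=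
        hpos.trans_le (iInf_le (fun v : {u : ℕ → 𝒰R // ∀ t, u t ∈ URhat} =>
          J fR fH rH γ x' uH v.val) ⟨fun _ => uR0, fun _ => hA2⟩)
      exact hlt.ne' hbot
    · rw [← h0]
      exact (bot_lt_JH_step hγ0 hrtop hA2 hpos).trans_le (le_iSup _ _)
  have hstep : ∀ x', x' ∈ backupSafe fR fH Xsafe uR0 UH0 ∨ JHval fR fH rH γ URhat x' > ⊥ →
      (x' ∈ Xsafe ∧ fH x' (πH x') ∈ Xsafe) ∧
        (fR (fH x' (πH x')) uR0 ∈ backupSafe fR fH Xsafe uR0 UH0 ∨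
          JHval fR fH rH γ URhat (fR (fH x' (πH x')) uR0) > ⊥) := by
    intro x' hx'
    rcases eq_bot_or_bot_lt (JHval fR fH rH γ URhat x') with hbot | hpos
    · have hb := hx'.resolve_right (hbot ▸ lt_irrefl _)
      exact ⟨hb (fun _ => πH x') (fun _ => hA3 x' hbot) 0 0 le_rfl,
        Or.inl (backupSafe_step hb (hA3 x' hbot))⟩
    · exact ⟨(hval x' hpos).1, Or.inr (hval x' hpos).2⟩
  have hrobot : ∀ y, (fR y uR0 ∈ backupSafe fR fH Xsafe uR0 UH0 ∨
      JHval fR fH rH γ URhat (fR y uR0) > ⊥) →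
      fR y (πR y) ∈ backupSafe fR fH Xsafe uR0 UH0 ∨
        JHval fR fH rH γ URhat (fR y (πR y)) > ⊥ := by
    intro y hy
    by_cases h : πR y = uR0
    · rwa [h]
    · exact Or.inl (Xrec_subset_backupSafe _ _ _ _ _ k (hshield y h))
  have hinv : ∀ t, x t ∈ Xsafe ∧ (fR (x t) (πR (x t)) ∈ backupSafe fR fH Xsafe uR0 UH0 ∨
      JHval fR fH rH γ URhat (fR (x t) (πR (x t))) > ⊥) := by
    intro t
    induction t with
    | zero =>
      rw [hx0]
      refine ⟨hx₀.1, hrobot x₀ (Or.inl ?_)⟩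
      rw [hx₀.2.1]
      exact Xeq_subset_backupSafe _ _ _ _ _ hx₀
    | succ t ih =>
      obtain ⟨hs, hn⟩ := hstep _ ih.2
      rw [hxsucc]
      exact ⟨hs.2, hrobot _ hn⟩
  exact fun t => ⟨(hinv t).1, (hstep _ (hinv t).2).1.1⟩
end
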